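/- Let δ = (4√7 + 2)/27 and γ = 1 − 1/√7. For every red-blue edge-coloring of K_n (with vertex set {1,...,n}) there exists k ∈ {⌊δn⌋, n} and a monochromatic family F of pairwise vertex-disjoint triangles such that the number of vertices of F lying in {1,...,k} is at least γk − 7. -/

import Mathlib

/-- `T` is a triangle of color `col` under the edge-coloring `c`. -/
def IsTri {V : Type*} [DecidableEq V] (c : V → V → Bool) (col : Bool) (T : Finset V) : Prop :=
  T.card = 3 ∧ ∀ x ∈ T, ∀ y ∈ T, x ≠ y → c x y = col

section
open Finset

/-- `U` is exactly covered by disjoint triangles of color `col`. -/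
def Cov {V : Type*} [DecidableEq V] (c : V → V → Bool) (col : Bool) (U : Finset V) : Prop :=
  ∃ F : Finset (Finset V), (∀ T ∈ F, IsTri c col T) ∧
    (F : Set (Finset V)).Pairwise Disjoint ∧ F.biUnion id = U

section
variable {V : Type*} [DecidableEq V] {c : V → V → Bool} {col : Bool}

theorem bool_not {x y : Bool} (h : ¬ x = y) : x = !y := by
  cases x <;> cases y <;> simp_all

theorem Cov.empty : Cov c col ∅ := ⟨∅, by simp, by simp, by simp⟩

theorem Cov.tri {T : Finset V} (h : IsTri c col T) : Cov c col T :=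
  ⟨{T}, by simpa using h, by simp, by simp⟩

theorem Cov.union {U W : Finset V} (hU : Cov c col U) (hW : Cov c col W) (hd : Disjoint U W) :
    Cov c col (U ∪ W) := by
  obtain ⟨F, hF, hFd, hFU⟩ := hU
  obtain ⟨G, hG, hGd, hGW⟩ := hW
  have h1 : ∀ T ∈ F, T ⊆ U := fun T hT => hFU ▸ subset_biUnion_of_mem id hT
  have h2 : ∀ T ∈ G, T ⊆ W := fun T hT => hGW ▸ subset_biUnion_of_mem id hT
  refine ⟨F ∪ G, ?_, ?_, ?_⟩
  · intro T hT
    rcases mem_union.1 hT with h | h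
    · exact hF T h
    · exact hG T h
  · intro T hT T' hT' hne
    rcases mem_union.1 (mem_coe.1 hT) with h | h <;> rcases mem_union.1 (mem_coe.1 hT') with h' | h'
    · exact hFd h h' hne
    · exact (hd.mono_left (h1 T h)).mono_right (h2 T' h')
    · exact ((hd.mono_left (h1 T' h')).mono_right (h2 T h)).symm
    · exact hGd h h' hne
  · rw [← hFU, ← hGW]; ext x; simp only [mem_biUnion, mem_union, id]
    constructor
    · rintro ⟨T, hT | hT, hx⟩
      · exact Or.inl ⟨T, hT, hx⟩
      · exact Or.inr ⟨T, hT, hx⟩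
    · rintro (⟨T, hT, hx⟩ | ⟨T, hT, hx⟩)
      · exact ⟨T, Or.inl hT, hx⟩
      · exact ⟨T, Or.inr hT, hx⟩

theorem Cov.bUnion {ι : Type*} [DecidableEq ι] (I : Finset ι) (g : ι → Finset V)
    (hd : ∀ i ∈ I, ∀ j ∈ I, i ≠ j → Disjoint (g i) (g j))
    (h : ∀ i ∈ I, Cov c col (g i)) : Cov c col (I.biUnion g) := by
  induction I using Finset.induction_on with
  | empty => simpa using Cov.empty
  | insert a s ha ih =>
    rw [biUnion_insert]
    refine Cov.union (h a (by simp)) (ih ?_ ?_) ?_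
    · intro i hi j hj; exact hd i (by simp [hi]) j (by simp [hj])
    · intro i hi; exact h i (by simp [hi])
    · rw [disjoint_biUnion_right]
      intro i hi
      exact hd a (by simp) i (by simp [hi]) (by rintro rfl; exact ha hi)

theorem Cov.shrink {U : Finset V} (h : Cov c col U) (m : ℕ) (hm : m ≤ U.card) :
    ∃ U' ⊆ U, Cov c col U' ∧ U'.card ≤ m ∧ m ≤ U'.card + 2 := by
  obtain ⟨F, hF, hFd, hFU⟩ := h
  have hc : ∀ G ⊆ F, (G.biUnion id).card = 3 * G.card := by
    intro G hG
    rw [card_biUnion]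
    · rw [sum_congr rfl (fun T hT => show (id T : Finset V).card = 3 from (hF T (hG hT)).1)]; simp [mul_comm]
    · intro x hx y hy hne; exact hFd (hG hx) (hG hy) hne
  have hU := hc F (Subset.refl _)
  rw [hFU] at hU
  obtain ⟨G, hG, hGc⟩ := exists_subset_card_eq (s := F) (n := m / 3) (by omega)
  refine ⟨G.biUnion id, ?_, ⟨G, fun T hT => hF T (hG hT), fun x hx y hy => hFd (hG hx) (hG hy), rfl⟩, ?_, ?_⟩
  · rw [← hFU]; exact biUnion_subset_biUnion_of_subset_left _ hG
  · rw [hc G hG]; omega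
  · rw [hc G hG]; omega

theorem isTri_mk (hsym : ∀ x y, c x y = c y x) {x y z : V} (h1 : x ≠ y) (h2 : x ≠ z) (h3 : y ≠ z)
    (c1 : c x y = col) (c2 : c x z = col) (c3 : c y z = col) : IsTri c col {x, y, z} := by
  refine ⟨card_eq_three.2 ⟨x, y, z, h1, h2, h3, rfl⟩, ?_⟩
  intro a ha b hb hab
  simp only [mem_insert, mem_singleton] at ha hb
  rcases ha with rfl | rfl | rfl <;> rcases hb with rfl | rfl | rfl <;>
    first | exact absurd rfl hab | assumption | (rw [hsym]; assumption)

theorem ramsey33 (hsym : ∀ x y, c x y = c y x) (U : Finset V) (hU : 6 ≤ U.card) :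
    ∃ T ⊆ U, ∃ κ, IsTri c κ T := by
  obtain ⟨x, hx⟩ : U.Nonempty := card_pos.1 (by omega)
  have key : ∃ κ, 3 ≤ ((U.erase x).filter (fun y => c x y = κ)).card := by
    by_contra! hcon
    have h1 := hcon true
    have h2 := hcon false
    have h3 := card_filter_add_card_filter_not (s := U.erase x) (fun y => c x y = true)
    have h4 : (U.erase x).filter (fun y => ¬ c x y = true) = (U.erase x).filter (fun y => c x y = false) := by
      ext; simp
    rw [h4, card_erase_of_mem hx] at h3
    omega
  obtain ⟨κ, hκ⟩ := key
  obtain ⟨S, hS, hS3⟩ := exists_subset_card_eq hκ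
  obtain ⟨a, b, d, hab, had, hbd, rfl⟩ := card_eq_three.1 hS3
  have m : ∀ y ∈ ({a, b, d} : Finset V), y ∈ U ∧ y ≠ x ∧ c x y = κ := by
    intro y hy
    have := hS hy
    simp only [mem_filter, mem_erase] at this
    tauto
  have ma := m a (by simp)
  have mb := m b (by simp)
  have md := m d (by simp)
  by_cases e1 : c a b = κ
  · exact ⟨{x, a, b}, by simp [insert_subset_iff, *], κ, isTri_mk hsym ma.2.1.symm mb.2.1.symm hab ma.2.2 mb.2.2 e1⟩
  by_cases e2 : c a d = κ
  · exact ⟨{x, a, d}, by simp [insert_subset_iff, *], κ, isTri_mk hsym ma.2.1.symm md.2.1.symm had ma.2.2 md.2.2 e2⟩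
  by_cases e3 : c b d = κ
  · exact ⟨{x, b, d}, by simp [insert_subset_iff, *], κ, isTri_mk hsym mb.2.1.symm md.2.1.symm hbd mb.2.2 md.2.2 e3⟩
  exact ⟨{a, b, d}, by simp [insert_subset_iff, *], !κ, isTri_mk hsym hab had hbd
    (bool_not e1) (bool_not e2) (bool_not e3)⟩

theorem moon (hsym : ∀ x y, c x y = c y x) (κ : Bool) (U : Finset V) :
    ∃ X Y, X ⊆ U ∧ Y ⊆ U ∧ Disjoint X Y ∧ Cov c κ X ∧ Cov c (!κ) Y ∧ U.card ≤ X.card + Y.card + 5 := by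
  induction h : U.card using Nat.strong_induction_on generalizing U with
  | _ N ih =>
    by_cases h6 : 6 ≤ U.card
    · obtain ⟨T, hT, κ', hT3⟩ := ramsey33 hsym U h6
      have hc : (U \ T).card = U.card - 3 := by rw [card_sdiff_of_subset hT, hT3.1]
      obtain ⟨X, Y, hX, hY, hd, cX, cY, hle⟩ := ih (U \ T).card (by omega) (U \ T) rfl
      have dX : Disjoint T X := disjoint_of_subset_right hX disjoint_sdiff
      have dY : Disjoint T Y := disjoint_of_subset_right hY disjoint_sdiff
      have hX' : X ⊆ U := hX.trans sdiff_subset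
      have hY' : Y ⊆ U := hY.trans sdiff_subset
      by_cases hk : κ' = κ
      · subst hk
        refine ⟨T ∪ X, Y, union_subset hT hX', hY', ?_, (Cov.tri hT3).union cX dX, cY, ?_⟩
        · rw [disjoint_union_left]; exact ⟨dY, hd⟩
        · rw [card_union_of_disjoint dX, hT3.1]; omega
      · have : κ' = !κ := by cases κ <;> cases κ' <;> simp_all
        subst this
        refine ⟨X, T ∪ Y, hX', union_subset hT hY', ?_, cX, (Cov.tri hT3).union cY dY, ?_⟩
        · rw [disjoint_union_right]; exact ⟨dX.symm, hd⟩
        · rw [card_union_of_disjoint dY, hT3.1]; omega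
    · exact ⟨∅, ∅, by simp, by simp, by simp, Cov.empty, Cov.empty, by simp; omega⟩

theorem mono_cover (hsym : ∀ x y, c x y = c y x) (κ : Bool) (U : Finset V)
    (hU : ∀ T ⊆ U, ¬ IsTri c (!κ) T) : ∃ X ⊆ U, Cov c κ X ∧ U.card ≤ X.card + 5 := by
  obtain ⟨X, Y, hX, hY, -, cX, ⟨F, hF, -, hFY⟩, hle⟩ := moon hsym κ U
  have : F = ∅ := by
    apply eq_empty_of_forall_notMem
    intro T hT
    exact hU T (subset_trans (hFY ▸ subset_biUnion_of_mem id hT) hY) (hF T hT)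
  subst this
  have : Y.card = 0 := by rw [← hFY]; simp
  exact ⟨X, hX, cX, by omega⟩

theorem clique_cover (U : Finset V)
    (hU : ∀ x ∈ U, ∀ y ∈ U, x ≠ y → c x y = col) : ∃ X ⊆ U, Cov c col X ∧ U.card ≤ X.card + 2 := by
  induction h : U.card using Nat.strong_induction_on generalizing U with
  | _ N ih =>
    by_cases h3 : 3 ≤ U.card
    · obtain ⟨T, hT, hT3⟩ := exists_subset_card_eq h3
      have hc : (U \ T).card = U.card - 3 := by rw [card_sdiff_of_subset hT, hT3]
      obtain ⟨X, hX, cX, hle⟩ := ih (U \ T).card (by omega) (U \ T)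
        (fun x hx y hy => hU x (mem_sdiff.1 hx).1 y (mem_sdiff.1 hy).1) rfl
      have dX : Disjoint T X := disjoint_of_subset_right hX disjoint_sdiff
      refine ⟨T ∪ X, union_subset hT (hX.trans sdiff_subset),
        (Cov.tri ⟨hT3, fun x hx y hy => hU x (hT hx) y (hT hy)⟩).union cX dX, ?_⟩
      rw [card_union_of_disjoint dX, hT3]; omega
    · exact ⟨∅, by simp, Cov.empty, by simp; omega⟩

/-- maximal family of triangles with one vertex in `E` and two in `W` -/
theorem friends (hsym : ∀ x y, c x y = c y x) (μ : Bool) (E W : Finset V) (hd : Disjoint E W) :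
    ∃ E' W', E' ⊆ E ∧ W' ⊆ W ∧ W'.card = 2 * E'.card ∧ Cov c μ (E' ∪ W') ∧
      ∀ v ∈ E, v ∉ E' → ∀ x ∈ W, x ∉ W' → ∀ y ∈ W, y ∉ W' → x ≠ y → c v x = μ → c v y = μ →
        c x y ≠ μ := by
  induction h : E.card using Nat.strong_induction_on generalizing E W with
  | _ N ih =>
    by_cases hex : ∃ v ∈ E, ∃ x ∈ W, ∃ y ∈ W, x ≠ y ∧ c v x = μ ∧ c v y = μ ∧ c x y = μ
    · obtain ⟨v, hv, x, hx, y, hy, hxy, c1, c2, c3⟩ := hex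
      have hvx : v ≠ x := by rintro rfl; exact disjoint_left.1 hd hv hx
      have hvy : v ≠ y := by rintro rfl; exact disjoint_left.1 hd hv hy
      obtain ⟨E', W', hE, hW, hc, hcov, hmax⟩ := ih (E.erase v).card
        (by rw [← h]; exact card_erase_lt_of_mem hv) (E.erase v) (W \ {x, y})
        ((hd.mono_left (erase_subset _ _)).mono_right sdiff_subset) rfl
      have hE1 : ∀ z ∈ E', z ≠ v ∧ z ∈ E := fun z hz => mem_erase.1 (hE hz)
      have hW1 : ∀ z ∈ W', z ∈ W ∧ z ≠ x ∧ z ≠ y := fun z hz => by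
        have := hW hz; simp at this; tauto
      have hdW : Disjoint {x, y} W' := by
        rw [disjoint_left]; intro z hz hz'
        have := hW1 z hz'; simp at hz; tauto
      have hdd : ∀ z ∈ E, z ∉ W := fun z hz => disjoint_left.1 hd hz
      refine ⟨insert v E', {x, y} ∪ W', ?_, ?_, ?_, ?_, ?_⟩
      · intro z hz
        rcases mem_insert.1 hz with rfl | hz
        · exact hv
        · exact (hE1 z hz).2
      · intro z hz
        simp only [mem_union, mem_insert, mem_singleton] at hz
        rcases hz with (rfl | rfl) | hz
        · exact hx
        · exact hy
        · exact (hW1 z hz).1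
      · rw [card_union_of_disjoint hdW, card_pair hxy, card_insert_of_notMem (fun hh => (hE1 v hh).1 rfl), hc]
        ring
      · have : insert v E' ∪ ({x, y} ∪ W') = {v, x, y} ∪ (E' ∪ W') := by
          ext z; simp; tauto
        rw [this]
        refine (Cov.tri (isTri_mk hsym hvx hvy hxy c1 c2 c3)).union hcov ?_
        rw [disjoint_left]
        intro z hz hz'
        simp only [mem_union, mem_insert, mem_singleton] at hz hz'
        rcases hz' with hz' | hz'
        · have h5 := hE1 z hz'
          rcases hz with rfl | rfl | rfl
          · exact h5.1 rfl
          · exact hdd _ h5.2 hx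
          · exact hdd _ h5.2 hy
        · have h5 := hW1 z hz'
          rcases hz with rfl | rfl | rfl
          · exact hdd _ hv h5.1
          · exact h5.2.1 rfl
          · exact h5.2.2 rfl
      · intro u hu hu' a ha ha' b hb hb'
        simp only [mem_union, mem_insert, mem_singleton, not_or] at hu' ha' hb'
        exact hmax u (mem_erase.2 ⟨hu'.1, hu⟩) hu'.2 a (by simp; tauto) ha'.2 b (by simp; tauto) hb'.2
    · push Not at hex
      exact ⟨∅, ∅, by simp, by simp, by simp, by simpa using Cov.empty,
        fun v hv _ x hx _ y hy _ hxy h1 h2 => hex v hv x hx y hy hxy h1 h2⟩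

theorem gain {ι : Type*} [DecidableEq ι] (hsym : ∀ x y, c x y = c y x) (κ : Bool) (P D : Finset ι) (hDP : D ⊆ P)
    (T : ι → Fin 3 → V)
    (hinj : ∀ g ∈ P, ∀ h ∈ P, ∀ i j, T g i = T h j → g = h ∧ i = j)
    (h01 : ∀ g ∈ P, c (T g 0) (T g 1) = κ) (h02 : ∀ g ∈ P, c (T g 0) (T g 2) = κ)
    (h12 : ∀ g ∈ P, c (T g 1) (T g 2) = κ)
    (M Z X : Finset V) (hM : Cov c κ M) (hMZ : Disjoint M Z)
    (hPM : ∀ g ∈ P, ∀ i, T g i ∉ M) (hPZ : ∀ g ∈ P, ∀ i, T g i ∉ Z)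
    (hun1 : ∀ g ∈ D, ∀ x ∈ Z, ∀ y ∈ Z, x ≠ y → c (T g 1) x = !κ → c (T g 1) y = !κ → c x y = κ)
    (hun2 : ∀ g ∈ D, ∀ x ∈ Z, ∀ y ∈ Z, x ≠ y → c (T g 2) x = !κ → c (T g 2) y = !κ → c x y = κ)
    (hX : ∀ x ∈ X, ∃ g ∈ D, T g 0 = x) (hXc : Cov c κ X)
    (m : ℕ) (hm : m ≤ X.card) (hmZ : 2 * m ≤ Z.card) :
    ∃ U, Cov c κ U ∧ M.card + 3 * P.card + m ≤ U.card + 4 := by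
  classical
  -- generic facts about blocks of triangles of `P`
  have hne : ∀ g ∈ P, ∀ i j, i ≠ j → T g i ≠ T g j := fun g hg i j hij h =>
    hij (hinj g hg g hg i j h).2
  have htri : ∀ g ∈ P, IsTri c κ {T g 0, T g 1, T g 2} := fun g hg =>
    isTri_mk hsym (hne g hg 0 1 (by decide)) (hne g hg 0 2 (by decide)) (hne g hg 1 2 (by decide))
      (h01 g hg) (h02 g hg) (h12 g hg)
  have mem3 : ∀ g x, x ∈ ({T g 0, T g 1, T g 2} : Finset V) ↔ ∃ i, x = T g i := by
    intro g x
    simp only [mem_insert, mem_singleton, Fin.exists_fin_succ]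
    simp
  have hdisj : ∀ g ∈ P, ∀ h ∈ P, g ≠ h →
      Disjoint ({T g 0, T g 1, T g 2} : Finset V) {T h 0, T h 1, T h 2} := by
    intro g hg h hh hgh
    rw [disjoint_left]
    intro x hx hx'
    rw [mem3] at hx hx'
    obtain ⟨i, rfl⟩ := hx
    obtain ⟨j, hj⟩ := hx'
    exact hgh (hinj g hg h hh i j hj).1
  have blk : ∀ Q ⊆ P, Cov c κ (Q.biUnion fun g => {T g 0, T g 1, T g 2}) ∧
      (Q.biUnion fun g => ({T g 0, T g 1, T g 2} : Finset V)).card = 3 * Q.card := by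
    intro Q hQ
    refine ⟨Cov.bUnion _ _ (fun g hg h hh => hdisj g (hQ hg) h (hQ hh))
      (fun g hg => Cov.tri (htri g (hQ hg))), ?_⟩
    rw [card_biUnion (fun g hg h hh => hdisj g (hQ hg) h (hQ hh)),
      sum_congr rfl (fun g hg => (htri g (hQ hg)).1)]
    simp [mul_comm]
  have memblk : ∀ (Q : Finset ι) x, x ∈ (Q.biUnion fun g => ({T g 0, T g 1, T g 2} : Finset V)) ↔
      ∃ g ∈ Q, ∃ i, x = T g i := by
    intro Q x
    simp only [mem_biUnion, mem3]
  by_cases hbad : ∃ g ∈ D, m ≤ (Z.filter fun z => c (T g 1) z = !κ ∨ c (T g 2) z = !κ).card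
  · obtain ⟨g, hg, hgm⟩ := hbad
    obtain ⟨N1, hN1, cN1, l1⟩ := clique_cover (c := c) (col := κ) (Z.filter fun z => c (T g 1) z = !κ) (by
      intro x hx y hy hxy
      rw [mem_filter] at hx hy
      exact hun1 g hg x hx.1 y hy.1 hxy hx.2 hy.2)
    obtain ⟨N2, hN2, cN2, l2⟩ := clique_cover (c := c) (col := κ)
      ((Z.filter fun z => c (T g 2) z = !κ) \ (Z.filter fun z => c (T g 1) z = !κ)) (by
      intro x hx y hy hxy
      rw [mem_sdiff, mem_filter] at hx hy
      exact hun2 g hg x hx.1.1 y hy.1.1 hxy hx.1.2 hy.1.2)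
    have hd12 : Disjoint N1 N2 :=
      (disjoint_sdiff.mono_left hN1).mono_right hN2
    have hN1Z : N1 ⊆ Z := hN1.trans (filter_subset _ _)
    have hN2Z : N2 ⊆ Z := hN2.trans (sdiff_subset.trans (filter_subset _ _))
    have hcard : (Z.filter fun z => c (T g 1) z = !κ ∨ c (T g 2) z = !κ).card ≤
        (Z.filter fun z => c (T g 1) z = !κ).card +
        ((Z.filter fun z => c (T g 2) z = !κ) \ (Z.filter fun z => c (T g 1) z = !κ)).card := by
      rw [← card_union_of_disjoint disjoint_sdiff, union_sdiff_self_eq_union, ← filter_or]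
    obtain ⟨cb, kb⟩ := blk P (Subset.refl _)
    have dB : Disjoint (P.biUnion fun g => ({T g 0, T g 1, T g 2} : Finset V)) Z := by
      rw [disjoint_left]; intro x hx hxZ
      obtain ⟨g, hg, i, rfl⟩ := (memblk P x).1 hx
      exact hPZ g hg i hxZ
    have dBM : Disjoint M (P.biUnion fun g => ({T g 0, T g 1, T g 2} : Finset V)) := by
      rw [disjoint_right]; intro x hx hxZ
      obtain ⟨g, hg, i, rfl⟩ := (memblk P x).1 hx
      exact hPM g hg i hxZ
    have hNZ : N1 ∪ N2 ⊆ Z := union_subset hN1Z hN2Z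
    have d3 : Disjoint (M ∪ P.biUnion fun g => ({T g 0, T g 1, T g 2} : Finset V)) (N1 ∪ N2) := by
      rw [disjoint_union_left]
      exact ⟨hMZ.mono_right hNZ, dB.mono_right hNZ⟩
    refine ⟨_, (hM.union cb dBM).union (cN1.union cN2 hd12) d3, ?_⟩
    rw [card_union_of_disjoint d3, card_union_of_disjoint dBM, card_union_of_disjoint hd12, kb]
    omega
  · push Not at hbad
    obtain ⟨Y, hYX, cY, hY1, hY2⟩ := hXc.shrink m hm
    let I : Finset ι := D.filter fun g => T g 0 ∈ Y
    have hID : I ⊆ D := filter_subset _ _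
    have hIP : I ⊆ P := hID.trans hDP
    have hIY : I.image (fun g => T g 0) = Y := by
      ext x
      simp only [I, mem_image, mem_filter]
      constructor
      · rintro ⟨g, ⟨_, h⟩, rfl⟩; exact h
      · intro hx
        obtain ⟨g, hg, rfl⟩ := hX x (hYX hx)
        exact ⟨g, ⟨hg, hx⟩, rfl⟩
    have hIc : I.card = Y.card := by
      rw [← hIY, card_image_of_injOn]
      intro g hg h hh hgh
      exact (hinj g (hIP hg) h (hIP hh) 0 0 hgh).1
    let good : I → Finset V := fun g => Z.filter fun z => ¬ (c (T g.1 1) z = !κ ∨ c (T g.1 2) z = !κ)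
    have hgood : ∀ g : I, m ≤ (good g).card := by
      intro g
      have h1 := hbad g.1 (hID g.2)
      have h2 := card_filter_add_card_filter_not (s := Z)
        (fun z => c (T g.1 1) z = !κ ∨ c (T g.1 2) z = !κ)
      have h3 : (good g).card = (Z.filter fun z => ¬ (c (T g.1 1) z = !κ ∨ c (T g.1 2) z = !κ)).card := rfl
      omega
    obtain ⟨f, finj, hf⟩ := (all_card_le_biUnion_card_iff_exists_injective good).1 (by
      intro s
      rcases s.eq_empty_or_nonempty with rfl | ⟨g, hg⟩
      · simp
      · calc s.card ≤ Fintype.card I := card_le_univ _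
          _ = I.card := by simp
          _ ≤ m := by omega
          _ ≤ (good g).card := hgood g
          _ ≤ _ := card_le_card (subset_biUnion_of_mem good hg))
    have hf' : ∀ g : I, f g ∈ Z ∧ c (T g.1 1) (f g) = κ ∧ c (T g.1 2) (f g) = κ := by
      intro g
      have := hf g
      simp only [good, mem_filter, not_or] at this
      refine ⟨this.1, ?_, ?_⟩
      · have := bool_not this.2.1; simpa using this
      · have := bool_not this.2.2; simpa using this
    let S : I → Finset V := fun g => {T g.1 1, T g.1 2, f g}
    have memS : ∀ g x, x ∈ S g ↔ x = T g.1 1 ∨ x = T g.1 2 ∨ x = f g := by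
      intro g x; simp [S]
    have hS : ∀ g, IsTri c κ (S g) := by
      intro g
      have hg := hIP g.2
      refine isTri_mk hsym (hne _ hg 1 2 (by decide)) ?_ ?_ (h12 _ hg) (hf' g).2.1 (hf' g).2.2
      · intro h; exact hPZ _ hg 1 (h ▸ (hf' g).1)
      · intro h; exact hPZ _ hg 2 (h ▸ (hf' g).1)
    have hSd : ∀ g ∈ (univ : Finset I), ∀ h ∈ (univ : Finset I), g ≠ h → Disjoint (S g) (S h) := by
      intro g _ h _ hgh
      rw [disjoint_left]
      intro x hx hx'
      rw [memS] at hx hx'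
      have e1 : ∀ i j, T g.1 i ≠ T h.1 j := fun i j hij =>
        hgh (Subtype.ext (hinj _ (hIP g.2) _ (hIP h.2) i j hij).1)
      have e2 : ∀ i, T g.1 i ≠ f h := fun i hi => hPZ _ (hIP g.2) i (hi ▸ (hf' h).1)
      have e3 : ∀ i, f g ≠ T h.1 i := fun i hi => hPZ _ (hIP h.2) i (hi ▸ (hf' g).1)
      have e4 : f g ≠ f h := fun hi => hgh (finj hi)
      rcases hx with rfl | rfl | rfl <;> rcases hx' with hx | hx | hx
      · exact e1 _ _ hx
      · exact e1 _ _ hx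
      · exact e2 _ hx
      · exact e1 _ _ hx
      · exact e1 _ _ hx
      · exact e2 _ hx
      · exact e3 _ hx
      · exact e3 _ hx
      · exact e4 hx
    have cS : Cov c κ (univ.biUnion S) := Cov.bUnion _ _ hSd (fun g _ => Cov.tri (hS g))
    have kS : (univ.biUnion S).card = 3 * I.card := by
      rw [card_biUnion hSd, sum_congr rfl (fun g _ => (hS g).1)]
      simp [mul_comm]
    obtain ⟨cb, kb⟩ := blk (P \ I) sdiff_subset
    have dMB : Disjoint M ((P \ I).biUnion fun g => ({T g 0, T g 1, T g 2} : Finset V)) := by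
      rw [disjoint_right]; intro x hx hxZ
      obtain ⟨g, hg, i, rfl⟩ := (memblk _ x).1 hx
      exact hPM g (mem_sdiff.1 hg).1 i hxZ
    have dYS : Disjoint Y (univ.biUnion S) := by
      rw [disjoint_left]; intro x hx hxS
      rw [← hIY, mem_image] at hx
      obtain ⟨g, hg, rfl⟩ := hx
      obtain ⟨h, -, hh⟩ := mem_biUnion.1 hxS
      rw [memS] at hh
      rcases hh with hh | hh | hh
      · exact absurd (hinj _ (hIP hg) _ (hIP h.2) _ _ hh).2 (by decide)
      · exact absurd (hinj _ (hIP hg) _ (hIP h.2) _ _ hh).2 (by decide)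
      · exact hPZ _ (hIP hg) 0 (hh ▸ (hf' h).1)
    have d3 : Disjoint (M ∪ (P \ I).biUnion fun g => ({T g 0, T g 1, T g 2} : Finset V))
        (Y ∪ univ.biUnion S) := by
      rw [disjoint_right]
      intro x hx hx'
      have key : (∃ g ∈ I, ∃ i, x = T g i) ∨ x ∈ Z := by
        rcases mem_union.1 hx with hx | hx
        · rw [← hIY, mem_image] at hx
          obtain ⟨g, hg, rfl⟩ := hx
          exact Or.inl ⟨g, hg, 0, rfl⟩
        · obtain ⟨h, -, hh⟩ := mem_biUnion.1 hx
          rw [memS] at hh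
          rcases hh with rfl | rfl | rfl
          · exact Or.inl ⟨h.1, h.2, 1, rfl⟩
          · exact Or.inl ⟨h.1, h.2, 2, rfl⟩
          · exact Or.inr (hf' h).1
      rcases mem_union.1 hx' with hx' | hx'
      · rcases key with ⟨g, hg, i, rfl⟩ | hz
        · exact hPM g (hIP hg) i hx'
        · exact disjoint_left.1 hMZ hx' hz
      · obtain ⟨h, hh, j, rfl⟩ := (memblk _ x).1 hx'
        rw [mem_sdiff] at hh
        rcases key with ⟨g, hg, i, hgi⟩ | hz
        · have := (hinj _ hh.1 _ (hIP hg) _ _ hgi).1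
          subst this
          exact hh.2 hg
        · exact hPZ _ hh.1 _ hz
    refine ⟨_, (hM.union cb dMB).union (cY.union cS dYS) d3, ?_⟩
    rw [card_union_of_disjoint d3, card_union_of_disjoint dMB, card_union_of_disjoint dYS, kb, kS,
      card_sdiff_of_subset hIP]
    have := card_le_card hIP
    omega

/-- a bowtie: a `col`-triangle `g 0, g 1, g 2` and a `!col`-triangle `g 0, g 3, g 4` -/
def Bow (c : V → V → Bool) (col : Bool) (g : Fin 5 → V) : Prop :=
  Function.Injective g ∧ (c (g 0) (g 1) = col ∧ c (g 0) (g 2) = col ∧ c (g 1) (g 2) = col) ∧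
  (c (g 0) (g 3) = !col ∧ c (g 0) (g 4) = !col ∧ c (g 3) (g 4) = !col)

theorem bow_mk {v a b d e : V} (hva : v ≠ a) (hvb : v ≠ b) (hvd : v ≠ d) (hve : v ≠ e)
    (hab : a ≠ b) (had : a ≠ d) (hae : a ≠ e) (hbd : b ≠ d) (hbe : b ≠ e) (hde : d ≠ e)
    (c1 : c v a = col) (c2 : c v b = col) (c3 : c a b = col)
    (c4 : c v d = !col) (c5 : c v e = !col) (c6 : c d e = !col) : Bow c col ![v, a, b, d, e] := by
  refine ⟨?_, ⟨c1, c2, c3⟩, ⟨c4, c5, c6⟩⟩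
  intro i j h
  fin_cases i <;> fin_cases j <;> simp_all [eq_comm]

theorem six_bools : ∀ κ a1 a2 a3 b1 b2 b3 : Bool,
    (a1 = !κ ∧ a2 = !κ) ∨ (a1 = !κ ∧ a3 = !κ) ∨ (a2 = !κ ∧ a3 = !κ) ∨
    (b1 = !κ ∧ b2 = !κ) ∨ (b1 = !κ ∧ b3 = !κ) ∨ (b2 = !κ ∧ b3 = !κ) ∨
    (a1 = κ ∧ b1 = κ) ∨ (a2 = κ ∧ b2 = κ) ∨ (a3 = κ ∧ b3 = κ) := by decide

theorem tri_pop {T : Finset V} (h : IsTri c col T) {v : V} (hv : v ∈ T) :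
    ∃ a b, v ≠ a ∧ v ≠ b ∧ a ≠ b ∧ T = {v, a, b} := by
  have h2 : (T.erase v).card = 2 := by rw [card_erase_of_mem hv, h.1]
  obtain ⟨a, b, hab, he⟩ := card_eq_two.1 h2
  have ha : a ∈ T.erase v := by rw [he]; simp
  have hb : b ∈ T.erase v := by rw [he]; simp
  refine ⟨a, b, (mem_erase.1 ha).1.symm, (mem_erase.1 hb).1.symm, hab, ?_⟩
  rw [← he, insert_erase hv]

theorem exists_bow (hsym : ∀ x y, c x y = c y x) (κ : Bool) {S T : Finset V} (hS : IsTri c κ S)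
    (hT : IsTri c (!κ) T) : ∃ g, Bow c κ g ∧ ∀ i, g i ∈ S ∪ T := by
  by_cases hd : Disjoint S T
  · obtain ⟨x1, x2, x3, n12, n13, n23, rfl⟩ := card_eq_three.1 hS.1
    obtain ⟨y1, y2, y3, m12, m13, m23, rfl⟩ := card_eq_three.1 hT.1
    have cx12 := hS.2 x1 (by simp) x2 (by simp) n12
    have cx13 := hS.2 x1 (by simp) x3 (by simp) n13
    have cx23 := hS.2 x2 (by simp) x3 (by simp) n23
    have cy12 := hT.2 y1 (by simp) y2 (by simp) m12
    have cy13 := hT.2 y1 (by simp) y3 (by simp) m13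
    have cy23 := hT.2 y2 (by simp) y3 (by simp) m23
    have ne : ∀ x ∈ ({x1, x2, x3} : Finset V), ∀ y ∈ ({y1, y2, y3} : Finset V), x ≠ y := by
      rintro x hx y hy rfl
      exact disjoint_left.1 hd hx hy
    simp only [mem_insert, mem_singleton, forall_eq_or_imp, forall_eq] at ne
    obtain ⟨⟨n11, n12', n13'⟩, ⟨n21', n22', n23'⟩, ⟨n31', n32', n33'⟩⟩ := ne
    have fin : ∀ {v a b d e : V}, (v ∈ ({x1, x2, x3} : Finset V) ∪ {y1, y2, y3} ∧
        a ∈ ({x1, x2, x3} : Finset V) ∪ {y1, y2, y3} ∧ b ∈ ({x1, x2, x3} : Finset V) ∪ {y1, y2, y3} ∧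
        d ∈ ({x1, x2, x3} : Finset V) ∪ {y1, y2, y3} ∧ e ∈ ({x1, x2, x3} : Finset V) ∪ {y1, y2, y3}) →
        ∀ i, (![v, a, b, d, e] : Fin 5 → V) i ∈ ({x1, x2, x3} : Finset V) ∪ {y1, y2, y3} := by
      rintro v a b d e ⟨h1, h2, h3, h4, h5⟩ i
      fin_cases i <;> assumption
    have s12 := hsym x1 x2
    rcases six_bools κ (c x1 y1) (c x1 y2) (c x1 y3) (c x2 y1) (c x2 y2) (c x2 y3) with
      h | h | h | h | h | h | h | h | h
    · exact ⟨_, bow_mk (v := x1) (a := x2) (b := x3) (d := y1) (e := y2) n12 n13 ‹_› ‹_› n23 ‹_› ‹_› ‹_› ‹_› ‹_› cx12 cx13 cx23 h.1 h.2 ‹_›,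
        fin (by simp)⟩
    · exact ⟨_, bow_mk (v := x1) (a := x2) (b := x3) (d := y1) (e := y3) n12 n13 ‹_› ‹_› n23 ‹_› ‹_› ‹_› ‹_› ‹_› cx12 cx13 cx23 h.1 h.2 ‹_›,
        fin (by simp)⟩
    · exact ⟨_, bow_mk (v := x1) (a := x2) (b := x3) (d := y2) (e := y3) n12 n13 ‹_› ‹_› n23 ‹_› ‹_› ‹_› ‹_› ‹_› cx12 cx13 cx23 h.1 h.2 ‹_›,
        fin (by simp)⟩
    · exact ⟨_, bow_mk (v := x2) (a := x1) (b := x3) (d := y1) (e := y2) n12.symm n23 ‹_› ‹_› n13 ‹_› ‹_› ‹_› ‹_› ‹_› (s12 ▸ cx12) cx23 cx13 h.1 h.2 ‹_›,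
        fin (by simp)⟩
    · exact ⟨_, bow_mk (v := x2) (a := x1) (b := x3) (d := y1) (e := y3) n12.symm n23 ‹_› ‹_› n13 ‹_› ‹_› ‹_› ‹_› ‹_› (s12 ▸ cx12) cx23 cx13 h.1 h.2 ‹_›,
        fin (by simp)⟩
    · exact ⟨_, bow_mk (v := x2) (a := x1) (b := x3) (d := y2) (e := y3) n12.symm n23 ‹_› ‹_› n13 ‹_› ‹_› ‹_› ‹_› ‹_› (s12 ▸ cx12) cx23 cx13 h.1 h.2 ‹_›,
        fin (by simp)⟩
    · exact ⟨_, bow_mk (v := y1) (a := x1) (b := x2) (d := y2) (e := y3) n11.symm n21'.symm m12 m13 n12 n12' n13' n22' n23' m23 (by rw [hsym]; exact h.1) (by rw [hsym]; exact h.2) cx12 cy12 cy13 cy23, fin (by simp)⟩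
    · exact ⟨_, bow_mk (v := y2) (a := x1) (b := x2) (d := y1) (e := y3) n12'.symm n22'.symm m12.symm m23 n12 n11 n13' n21' n23' m13 (by rw [hsym]; exact h.1) (by rw [hsym]; exact h.2) cx12 (by rw [hsym]; exact cy12) cy23 cy13, fin (by simp)⟩
    · exact ⟨_, bow_mk (v := y3) (a := x1) (b := x2) (d := y1) (e := y2) n13'.symm n23'.symm m13.symm m23.symm n12 n11 n12' n21' n22' m12 (by rw [hsym]; exact h.1) (by rw [hsym]; exact h.2) cx12 (by rw [hsym]; exact cy13) (by rw [hsym]; exact cy23) cy12, fin (by simp)⟩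
  · rw [not_disjoint_iff] at hd
    obtain ⟨v, hvS, hvT⟩ := hd
    have only : ∀ x ∈ S, ∀ y ∈ T, v ≠ x → x ≠ y := by
      rintro x hx y hy hvx rfl
      have h1 := hS.2 v hvS x hx hvx
      have h2 := hT.2 v hvT x hy hvx
      rw [h1] at h2
      cases κ <;> simp at h2
    obtain ⟨a, b, hva, hvb, hab, hSe⟩ := tri_pop hS hvS
    obtain ⟨d, e, hvd, hve, hde, hTe⟩ := tri_pop hT hvT
    have ha : a ∈ S := by rw [hSe]; simp
    have hb : b ∈ S := by rw [hSe]; simp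
    have hdm : d ∈ T := by rw [hTe]; simp
    have he : e ∈ T := by rw [hTe]; simp
    refine ⟨_, bow_mk hva hvb hvd hve hab (only a ha d hdm hva) (only a ha e he hva)
      (only b hb d hdm hvb) (only b hb e he hvb) hde (hS.2 v hvS a ha hva) (hS.2 v hvS b hb hvb)
      (hS.2 a ha b hb hab) (hT.2 v hvT d hdm hvd) (hT.2 v hvT e he hve) (hT.2 d hdm e he hde), ?_⟩
    intro i
    fin_cases i <;> simp [*]

/-- a packing of bowties inside `U` -/
def Pack (c : V → V → Bool) (col : Bool) (U : Finset V) (P : Finset (Fin 5 → V)) : Prop :=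
  (∀ g ∈ P, Bow c col g ∧ ∀ i, g i ∈ U) ∧ ∀ g ∈ P, ∀ h ∈ P, ∀ i j, g i = h j → g = h

/-- vertices of a packing at positions in `I` -/
def cells (P : Finset (Fin 5 → V)) (I : Finset (Fin 5)) : Finset V :=
  (P ×ˢ I).image fun x => x.1 x.2

theorem mem_cells {P : Finset (Fin 5 → V)} {I : Finset (Fin 5)} {x : V} :
    x ∈ cells P I ↔ ∃ g ∈ P, ∃ i ∈ I, g i = x := by
  simp only [cells, mem_image, mem_product, Prod.exists]
  constructor
  · rintro ⟨g, i, ⟨h1, h2⟩, rfl⟩; exact ⟨g, h1, i, h2, rfl⟩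
  · rintro ⟨g, h1, i, h2, rfl⟩; exact ⟨g, i, ⟨h1, h2⟩, rfl⟩

theorem Pack.inj {U : Finset V} {P : Finset (Fin 5 → V)} (h : Pack c col U P) :
    ∀ g ∈ P, ∀ g' ∈ P, ∀ i j, g i = g' j → g = g' ∧ i = j := by
  intro g hg g' hg' i j hij
  have := h.2 g hg g' hg' i j hij
  subst this
  exact ⟨rfl, (h.1 g hg).1.1 hij⟩

theorem Pack.card_cells {U : Finset V} {P : Finset (Fin 5 → V)} (h : Pack c col U P)
    (I : Finset (Fin 5)) : (cells P I).card = P.card * I.card := by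
  rw [cells, card_image_of_injOn, card_product]
  rintro ⟨g, i⟩ hg ⟨g', i'⟩ hg' hh
  rw [mem_coe, mem_product] at hg hg'
  have := h.inj g hg.1 g' hg'.1 i i' hh
  exact Prod.ext this.1 this.2

theorem Pack.cells_subset {U : Finset V} {P : Finset (Fin 5 → V)} (h : Pack c col U P)
    (I : Finset (Fin 5)) : cells P I ⊆ U := by
  intro x hx
  obtain ⟨g, hg, i, -, rfl⟩ := mem_cells.1 hx
  exact (h.1 g hg).2 i

theorem Pack.disj {U : Finset V} {P : Finset (Fin 5 → V)} (h : Pack c col U P)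
    {I J : Finset (Fin 5)} (hd : Disjoint I J) : Disjoint (cells P I) (cells P J) := by
  rw [disjoint_left]
  intro x hx hx'
  obtain ⟨g, hg, i, hi, rfl⟩ := mem_cells.1 hx
  obtain ⟨g', hg', j, hj, hij⟩ := mem_cells.1 hx'
  have := (h.inj g' hg' g hg j i hij).2
  subst this
  exact disjoint_left.1 hd hi hj

theorem Pack.cov_red (hsym : ∀ x y, c x y = c y x) {U : Finset V} {P : Finset (Fin 5 → V)}
    (h : Pack c col U P) : Cov c col (cells P {0, 1, 2}) := by
  have : cells P {0, 1, 2} = P.biUnion fun g => {g 0, g 1, g 2} := by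
    ext x; simp only [mem_cells, mem_biUnion]; simp [eq_comm]
  rw [this]
  apply Cov.bUnion
  · intro g hg g' hg' hne
    rw [disjoint_left]
    intro x hx hx'
    have e : ∀ i j, g i ≠ g' j := fun i j hij => hne (h.inj g hg g' hg' i j hij).1
    simp only [mem_insert, mem_singleton] at hx hx'
    rcases hx with rfl | rfl | rfl <;> rcases hx' with hx | hx | hx <;> exact e _ _ hx
  · intro g hg
    obtain ⟨⟨gi, g1, -⟩, -⟩ := h.1 g hg
    exact Cov.tri (isTri_mk hsym (gi.ne (by decide)) (gi.ne (by decide)) (gi.ne (by decide)) g1.1 g1.2.1 g1.2.2)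

theorem Pack.cov_blue (hsym : ∀ x y, c x y = c y x) {U : Finset V} {P : Finset (Fin 5 → V)}
    (h : Pack c col U P) : Cov c (!col) (cells P {0, 3, 4}) := by
  have : cells P {0, 3, 4} = P.biUnion fun g => {g 0, g 3, g 4} := by
    ext x; simp only [mem_cells, mem_biUnion]; simp [eq_comm]
  rw [this]
  apply Cov.bUnion
  · intro g hg g' hg' hne
    rw [disjoint_left]
    intro x hx hx'
    have e : ∀ i j, g i ≠ g' j := fun i j hij => hne (h.inj g hg g' hg' i j hij).1
    simp only [mem_insert, mem_singleton] at hx hx'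
    rcases hx with rfl | rfl | rfl <;> rcases hx' with hx | hx | hx <;> exact e _ _ hx
  · intro g hg
    obtain ⟨⟨gi, -, g1⟩, -⟩ := h.1 g hg
    exact Cov.tri (isTri_mk hsym (gi.ne (by decide)) (gi.ne (by decide)) (gi.ne (by decide)) g1.1 g1.2.1 g1.2.2)

theorem exists_pack (hsym : ∀ x y, c x y = c y x) (κ : Bool) (U : Finset V) :
    ∃ P, Pack c κ U P ∧ ((∀ T ⊆ U \ cells P univ, ¬ IsTri c (!κ) T) ∨
      (∀ T ⊆ U \ cells P univ, ¬ IsTri c κ T)) := by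
  induction h : U.card using Nat.strong_induction_on generalizing U with
  | _ N ih =>
    by_cases h1 : ∃ T ⊆ U, IsTri c (!κ) T
    · by_cases h2 : ∃ T ⊆ U, IsTri c κ T
      · obtain ⟨T, hTU, hT⟩ := h1
        obtain ⟨S, hSU, hS⟩ := h2
        obtain ⟨g, hg, hgU⟩ := exists_bow hsym κ hS hT
        have hgU' : ∀ i, g i ∈ U := fun i => union_subset hSU hTU (hgU i)
        obtain ⟨P, hP, hmono⟩ := ih (U \ univ.image g).card (by
          rw [← h]
          apply card_lt_card
          rw [ssubset_iff_of_subset sdiff_subset]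
          exact ⟨g 0, hgU' 0, by simp⟩) (U \ univ.image g) rfl
        have hPU : ∀ g' ∈ P, ∀ i, g' i ∈ U ∧ ∀ j, g j ≠ g' i := by
          intro g' hg' i
          have := (hP.1 g' hg').2 i
          simpa using this
        refine ⟨insert g P, ⟨?_, ?_⟩, ?_⟩
        · intro g' hg'
          rcases mem_insert.1 hg' with rfl | hg'
          · exact ⟨hg, hgU'⟩
          · exact ⟨(hP.1 g' hg').1, fun i => (hPU g' hg' i).1⟩
        · intro a ha b hb i j hij
          rcases mem_insert.1 ha with ea | ma <;> rcases mem_insert.1 hb with eb | mb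
          · rw [ea, eb]
          · rw [ea] at hij
            exact absurd hij ((hPU b mb j).2 i)
          · rw [eb] at hij
            exact absurd hij.symm ((hPU a ma i).2 j)
          · exact hP.2 a ma b mb i j hij
        · have : U \ cells (insert g P) univ = (U \ univ.image g) \ cells P univ := by
            ext x
            simp only [mem_sdiff, mem_cells, mem_insert, mem_image, mem_univ, true_and]
            constructor
            · rintro ⟨hx, hn⟩
              exact ⟨⟨hx, fun ⟨i, hi⟩ => hn ⟨g, Or.inl rfl, i, hi⟩⟩,
                fun ⟨g', hg', i, hi⟩ => hn ⟨g', Or.inr hg', i, hi⟩⟩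
            · rintro ⟨⟨hx, hn⟩, hn'⟩
              refine ⟨hx, ?_⟩
              rintro ⟨g', rfl | hg', i, hi⟩
              · exact hn ⟨i, hi⟩
              · exact hn' ⟨g', hg', i, hi⟩
          rw [this]; exact hmono
      · push Not at h2
        exact ⟨∅, ⟨by simp, by simp⟩, Or.inr fun T hT => h2 T (hT.trans sdiff_subset)⟩
    · push Not at h1
      exact ⟨∅, ⟨by simp, by simp⟩, Or.inl fun T hT => h1 T (hT.trans sdiff_subset)⟩

/-- exchanging the roles of the two colors -/
def sw : Fin 5 → Fin 5 := ![0, 3, 4, 1, 2]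

theorem sw_sw (i : Fin 5) : sw (sw i) = i := by revert i; decide

theorem exists_pack' (hsym : ∀ x y, c x y = c y x) (U : Finset V) :
    ∃ κ P, Pack c κ U P ∧ ∀ T ⊆ U \ cells P univ, ¬ IsTri c (!κ) T := by
  obtain ⟨P, hP, h | h⟩ := exists_pack hsym true U
  · exact ⟨true, P, hP, h⟩
  · refine ⟨false, P.image (fun g => g ∘ sw), ⟨?_, ?_⟩, ?_⟩
    · intro g' hg'
      obtain ⟨g, hg, rfl⟩ := mem_image.1 hg'
      obtain ⟨⟨gi, ga, gb⟩, gU⟩ := hP.1 g hg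
      refine ⟨⟨gi.comp (Function.LeftInverse.injective sw_sw), gb, ga⟩, fun i => gU _⟩
    · intro a ha b hb i j hij
      obtain ⟨g, hg, rfl⟩ := mem_image.1 ha
      obtain ⟨g', hg', rfl⟩ := mem_image.1 hb
      rw [hP.2 g hg g' hg' _ _ hij]
    · have : cells (P.image (fun g => g ∘ sw)) univ = cells P univ := by
        ext x
        simp only [mem_cells, mem_image, mem_univ, true_and]
        constructor
        · rintro ⟨_, ⟨g, hg, rfl⟩, i, hi⟩; exact ⟨g, hg, sw i, hi⟩
        · rintro ⟨g, hg, i, hi⟩; exact ⟨_, ⟨g, hg, rfl⟩, sw i, by simp [sw_sw, hi]⟩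
      rw [this]; exact h

theorem comb [Fintype V] (hsym : ∀ x y, c x y = c y x) (A : Finset V) :
    ∃ p q a fb fr D xr xb zr zb mr mb : ℕ, A.card = 5 * p + a ∧ 5 * (p + q) ≤ Fintype.card V ∧
      (∃ κ U, Cov c κ U ∧ 3 * p + fb ≤ (U ∩ A).card) ∧
      (∃ κ U, Cov c κ U ∧ 3 * p + a + fr ≤ (U ∩ A).card + 5) ∧
      p ≤ D + fb + fr ∧ D ≤ xr + xb + 5 ∧ 2 * q ≤ zr + 2 * fb ∧ 2 * q ≤ zb + a + 2 * fr ∧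
      (mr = xr ∨ zr ≤ 2 * mr + 1) ∧ (mb = xb ∨ zb ≤ 2 * mb + 1) ∧
      (((∃ κ U, Cov c κ U ∧ Fintype.card V + mr ≤ U.card + 2 * (p + q) + 9) ∧
        (∃ κ U, Cov c κ U ∧ 3 * (p + q) + mb ≤ U.card + 4)) ∨
       ((∃ κ U, Cov c κ U ∧ Fintype.card V + mb ≤ U.card + 2 * (p + q) + 9) ∧
        (∃ κ U, Cov c κ U ∧ 3 * (p + q) + mr ≤ U.card + 4))) := by
  obtain ⟨κ, P, hP, hA'⟩ := exists_pack' (c := c) hsym A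
  obtain ⟨Ac, hAcs, cAc, kAc⟩ := mono_cover hsym κ _ hA'
  set W : Finset V := univ \ cells P univ with hW
  obtain ⟨Q, hQ, hL⟩ := exists_pack (c := c) hsym κ W
  set L : Finset V := W \ cells Q univ with hLdef
  have cellsmono : ∀ (R : Finset (Fin 5 → V)) (I J : Finset (Fin 5)), I ⊆ J → cells R I ⊆ cells R J := by
    intro R I J hIJ x hx
    obtain ⟨g, hg, i, hi, rfl⟩ := mem_cells.1 hx
    exact mem_cells.2 ⟨g, hg, i, hIJ hi, rfl⟩
  have cP : ∀ I, cells P I ⊆ cells P univ := fun I => cellsmono P I univ (subset_univ _)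
  have cQ : ∀ I, cells Q I ⊆ cells Q univ := fun I => cellsmono Q I univ (subset_univ _)
  have kPu : (cells P univ).card = 5 * P.card := by rw [hP.card_cells]; simp [mul_comm]
  have kQu : (cells Q univ).card = 5 * Q.card := by rw [hQ.card_cells]; simp [mul_comm]
  have kA : (A \ cells P univ).card + 5 * P.card = A.card := by
    rw [← kPu]; exact card_sdiff_add_card_eq_card (hP.cells_subset _)
  have kW : W.card + 5 * P.card = Fintype.card V := by
    rw [← kPu, ← card_univ]; exact card_sdiff_add_card_eq_card (subset_univ _)
  have kL : L.card + 5 * Q.card = W.card := by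
    rw [← kQu]; exact card_sdiff_add_card_eq_card (hQ.cells_subset _)
  -- friends
  have dPW : ∀ I, Disjoint (cells P I) W := fun I => disjoint_sdiff.mono_left (cP I)
  have dPA : ∀ I, Disjoint (cells P I) (univ \ A) := fun I =>
    disjoint_sdiff.mono_left (hP.cells_subset I)
  obtain ⟨Eb, Wb, hEb, hWb, kWb, cEb, hfb⟩ := friends hsym (!κ) (cells P {1, 2}) W (dPW _)
  obtain ⟨Er, Wr, hEr, hWr, kWr, cEr, hfr⟩ := friends hsym κ (cells P {3, 4}) (univ \ A) (dPA _)
  have cov1 : ∃ κ U, Cov c κ U ∧ 3 * P.card + Eb.card ≤ (U ∩ A).card := by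
    have d1 : Disjoint (cells P {0, 3, 4}) Eb := (hP.disj (by decide)).mono_right hEb
    have d2 : Disjoint (cells P {0, 3, 4}) Wb := (dPW _).mono_right hWb
    refine ⟨!κ, _, (hP.cov_blue hsym).union cEb (disjoint_union_right.2 ⟨d1, d2⟩), ?_⟩
    have : (cells P {0, 3, 4} ∪ Eb).card = 3 * P.card + Eb.card := by
      rw [card_union_of_disjoint d1, hP.card_cells, show #({0, 3, 4} : Finset (Fin 5)) = 3 from by decide, mul_comm]
    rw [← this]
    apply card_le_card
    intro x hx
    rw [mem_inter]
    rcases mem_union.1 hx with h | h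
    · exact ⟨mem_union_left _ h, hP.cells_subset _ h⟩
    · exact ⟨mem_union_right _ (mem_union_left _ h), hP.cells_subset _ (hEb h)⟩
  have cov2 : ∃ κ U, Cov c κ U ∧ 3 * P.card + (A \ cells P univ).card + Er.card ≤ (U ∩ A).card + 5 := by
    have d0 : ∀ I, Disjoint (cells P I) Ac := fun I => (disjoint_sdiff.mono_left (cP I)).mono_right hAcs
    have d1 : Disjoint (cells P {0, 1, 2}) Er := (hP.disj (by decide)).mono_right hEr
    have d2 : Disjoint (cells P {0, 1, 2}) Wr := (dPA _).mono_right hWr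
    have hAcA : Ac ⊆ A := hAcs.trans sdiff_subset
    have d3 : Disjoint Ac Er := ((d0 _).mono_left hEr).symm
    have d4 : Disjoint Ac Wr := (disjoint_sdiff.mono_left hAcA).mono_right hWr
    refine ⟨κ, _, ((hP.cov_red hsym).union cAc (d0 _)).union cEr (by
      rw [disjoint_union_left, disjoint_union_right, disjoint_union_right]
      exact ⟨⟨d1, d2⟩, ⟨d3, d4⟩⟩), ?_⟩
    have : ((cells P {0, 1, 2} ∪ Ac) ∪ Er).card = 3 * P.card + Ac.card + Er.card := by
      rw [card_union_of_disjoint (disjoint_union_left.2 ⟨d1, d3⟩), card_union_of_disjoint (d0 _),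
        hP.card_cells, show #({0, 1, 2} : Finset (Fin 5)) = 3 from by decide, mul_comm]
    have h2 : ((cells P {0, 1, 2} ∪ Ac) ∪ Er).card ≤ ((cells P {0, 1, 2} ∪ Ac ∪ (Er ∪ Wr)) ∩ A).card := by
      apply card_le_card
      intro x hx
      rw [mem_inter]
      rcases mem_union.1 hx with h | h
      · refine ⟨mem_union_left _ h, ?_⟩
        rcases mem_union.1 h with h | h
        · exact hP.cells_subset _ h
        · exact hAcA h
      · exact ⟨mem_union_right _ (mem_union_left _ h), hP.cells_subset _ (hEr h)⟩
    omega
  -- the friendless bowties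
  let D : Finset (Fin 5 → V) := P.filter fun g => (g 1 ∉ Eb ∧ g 2 ∉ Eb) ∧ (g 3 ∉ Er ∧ g 4 ∉ Er)
  have hDP : D ⊆ P := filter_subset _ _
  have hDm : ∀ g ∈ D, (g 1 ∉ Eb ∧ g 2 ∉ Eb) ∧ (g 3 ∉ Er ∧ g 4 ∉ Er) := fun g hg => (mem_filter.1 hg).2
  have kD : P.card ≤ D.card + Eb.card + Er.card := by
    have h1 : (P \ D).card ≤ (Eb ∪ Er).card := by
      have hex : ∀ g ∈ P \ D, ∃ i, g i ∈ Eb ∪ Er := by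
        intro g hg
        rw [mem_sdiff] at hg
        by_contra! hcon
        apply hg.2
        have hc' : ∀ i, g i ∉ Eb ∧ g i ∉ Er := fun i => by simpa using hcon i
        exact mem_filter.2 ⟨hg.1, ⟨(hc' 1).1, (hc' 2).1⟩, ⟨(hc' 3).2, (hc' 4).2⟩⟩
      have hex2 : ∀ g : Fin 5 → V, ∃ i, g ∈ P \ D → g i ∈ Eb ∪ Er := by
        intro g
        by_cases hg : g ∈ P \ D
        · obtain ⟨i, hi⟩ := hex g hg; exact ⟨i, fun _ => hi⟩
        · exact ⟨0, fun h => absurd h hg⟩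
      choose φ hφ using hex2
      refine card_le_card_of_injOn (fun g => g (φ g)) (fun g hg => hφ g hg) ?_
      intro g hg g' hg' hgg
      exact (hP.inj g (mem_sdiff.1 hg).1 g' (mem_sdiff.1 hg').1 _ _ hgg).1
    have h2 := card_union_le Eb Er
    have h3 := card_sdiff_add_card_eq_card hDP
    omega
  obtain ⟨Xr, Xb, hXr, hXb, -, cXr, cXb, kX⟩ := moon (c := c) hsym κ (D.image fun g => g 0)
  have kD0 : (D.image fun g => g 0).card = D.card := by
    apply card_image_of_injOn
    intro g hg g' hg' h
    exact (hP.inj g (hDP hg) g' (hDP hg') 0 0 h).1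
  rw [kD0] at kX
  -- leftover
  obtain ⟨Lr, Lb, hLr, hLb, cLr, cLb, kLL⟩ : ∃ Lr Lb, Lr ⊆ L ∧ Lb ⊆ L ∧ Cov c κ Lr ∧ Cov c (!κ) Lb ∧
      (L.card ≤ Lr.card + 5 ∨ L.card ≤ Lb.card + 5) := by
    rcases hL with h | h
    · obtain ⟨X, hX, cX, kX⟩ := mono_cover hsym κ _ h
      exact ⟨X, ∅, hX, empty_subset _, cX, Cov.empty, Or.inl kX⟩
    · obtain ⟨X, hX, cX, kX⟩ := mono_cover hsym (!κ) L (by simpa using h)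
      exact ⟨∅, X, empty_subset _, hX, Cov.empty, cX, Or.inr kX⟩
  have dQL : ∀ I, Disjoint (cells Q I) L := fun I => disjoint_sdiff.mono_left (cQ I)
  have hLW : L ⊆ W := sdiff_subset
  have PW : ∀ g ∈ P, ∀ i, g i ∉ W := fun g hg i hi =>
    disjoint_left.1 (dPW univ) (mem_cells.2 ⟨g, hg, i, mem_univ _, rfl⟩) hi
  -- red gain
  let Zr : Finset V := cells Q {3, 4} \ Wb
  have hZrW : Zr ⊆ W := sdiff_subset.trans (hQ.cells_subset _)
  have kZr : 2 * Q.card ≤ Zr.card + 2 * Eb.card := by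
    have h1 := le_card_sdiff Wb (cells Q {3, 4})
    rw [hQ.card_cells, show #({3, 4} : Finset (Fin 5)) = 2 from by decide, kWb] at h1
    have : Zr.card = (cells Q {3, 4} \ Wb).card := rfl
    omega
  have hMr : Cov c κ (cells Q {0, 1, 2} ∪ Lr) := (hQ.cov_red hsym).union cLr ((dQL _).mono_right hLr)
  have hMrW : cells Q {0, 1, 2} ∪ Lr ⊆ W := union_subset (hQ.cells_subset _) (hLr.trans hLW)
  have kMr : (cells Q {0, 1, 2} ∪ Lr).card = 3 * Q.card + Lr.card := by
    rw [card_union_of_disjoint ((dQL _).mono_right hLr), hQ.card_cells,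
      show #({0, 1, 2} : Finset (Fin 5)) = 3 from by decide, mul_comm]
  obtain ⟨Ur, cUr, kUr⟩ := gain hsym κ P D hDP (fun g i => g ((![0, 1, 2] : Fin 3 → Fin 5) i))
    (by
      intro g hg h hh i j hij
      have := hP.inj g hg h hh _ _ hij
      exact ⟨this.1, (by decide : Function.Injective (![0, 1, 2] : Fin 3 → Fin 5)) this.2⟩)
    (fun g hg => (hP.1 g hg).1.2.1.1) (fun g hg => (hP.1 g hg).1.2.1.2.1)
    (fun g hg => (hP.1 g hg).1.2.1.2.2) (cells Q {0, 1, 2} ∪ Lr) Zr Xr hMr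
    (by
      rw [disjoint_union_left]
      exact ⟨(hQ.disj (by decide)).mono_right sdiff_subset,
        (((dQL _).mono_right hLr).mono_left sdiff_subset).symm⟩)
    (fun g hg i h => PW g hg _ (hMrW h)) (fun g hg i h => PW g hg _ (hZrW h))
    (by
      intro g hg x hx y hy hxy c1 c2
      have := bool_not (hfb (g 1) (mem_cells.2 ⟨g, hDP hg, 1, by decide, rfl⟩) (hDm g hg).1.1 x (hZrW hx)
        (mem_sdiff.1 hx).2 y (hZrW hy) (mem_sdiff.1 hy).2 hxy c1 c2)
      simpa using this)
    (by
      intro g hg x hx y hy hxy c1 c2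
      have := bool_not (hfb (g 2) (mem_cells.2 ⟨g, hDP hg, 2, by decide, rfl⟩) (hDm g hg).1.2 x (hZrW hx)
        (mem_sdiff.1 hx).2 y (hZrW hy) (mem_sdiff.1 hy).2 hxy c1 c2)
      simpa using this)
    (fun x hx => mem_image.1 (hXr hx)) cXr (min Xr.card (Zr.card / 2)) (min_le_left _ _)
    (by have := min_le_right Xr.card (Zr.card / 2); omega)
  -- blue gain
  let Zb : Finset V := (cells Q {1, 2} \ (A \ cells P univ)) \ Wr
  have hZbQ : Zb ⊆ cells Q {1, 2} := sdiff_subset.trans sdiff_subset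
  have hZbW : Zb ⊆ W := hZbQ.trans (hQ.cells_subset _)
  have hZbA : ∀ x ∈ Zb, x ∈ univ \ A := by
    intro x hx
    have h1 := hZbW hx
    have h2 := (mem_sdiff.1 (mem_sdiff.1 hx).1).2
    rw [hW, mem_sdiff] at h1
    rw [mem_sdiff] at h2 ⊢
    exact ⟨mem_univ _, fun h => h2 ⟨h, h1.2⟩⟩
  have kZb : 2 * Q.card ≤ Zb.card + (A \ cells P univ).card + 2 * Er.card := by
    have h1 := le_card_sdiff (A \ cells P univ) (cells Q {1, 2})
    have h2 := le_card_sdiff Wr (cells Q {1, 2} \ (A \ cells P univ))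
    rw [hQ.card_cells, show #({1, 2} : Finset (Fin 5)) = 2 from by decide] at h1
    have : Zb.card = ((cells Q {1, 2} \ (A \ cells P univ)) \ Wr).card := rfl
    omega
  have hMb : Cov c (!κ) (cells Q {0, 3, 4} ∪ Lb) := (hQ.cov_blue hsym).union cLb ((dQL _).mono_right hLb)
  have hMbW : cells Q {0, 3, 4} ∪ Lb ⊆ W := union_subset (hQ.cells_subset _) (hLb.trans hLW)
  have kMb : (cells Q {0, 3, 4} ∪ Lb).card = 3 * Q.card + Lb.card := by
    rw [card_union_of_disjoint ((dQL _).mono_right hLb), hQ.card_cells,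
      show #({0, 3, 4} : Finset (Fin 5)) = 3 from by decide, mul_comm]
  obtain ⟨Ub, cUb, kUb⟩ := gain hsym (!κ) P D hDP (fun g i => g ((![0, 3, 4] : Fin 3 → Fin 5) i))
    (by
      intro g hg h hh i j hij
      have := hP.inj g hg h hh _ _ hij
      exact ⟨this.1, (by decide : Function.Injective (![0, 3, 4] : Fin 3 → Fin 5)) this.2⟩)
    (fun g hg => (hP.1 g hg).1.2.2.1) (fun g hg => (hP.1 g hg).1.2.2.2.1)
    (fun g hg => (hP.1 g hg).1.2.2.2.2) (cells Q {0, 3, 4} ∪ Lb) Zb Xb hMb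
    (by
      rw [disjoint_union_left]
      exact ⟨(hQ.disj (by decide)).mono_right hZbQ,
        (((dQL _).mono_right hLb).mono_left hZbQ).symm⟩)
    (fun g hg i h => PW g hg _ (hMbW h)) (fun g hg i h => PW g hg _ (hZbW h))
    (by
      intro g hg x hx y hy hxy c1 c2
      rw [Bool.not_not] at c1 c2
      exact bool_not (hfr (g 3) (mem_cells.2 ⟨g, hDP hg, 3, by decide, rfl⟩) (hDm g hg).2.1 x (hZbA x hx)
        (mem_sdiff.1 hx).2 y (hZbA y hy) (mem_sdiff.1 hy).2 hxy c1 c2))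
    (by
      intro g hg x hx y hy hxy c1 c2
      rw [Bool.not_not] at c1 c2
      exact bool_not (hfr (g 4) (mem_cells.2 ⟨g, hDP hg, 4, by decide, rfl⟩) (hDm g hg).2.2 x (hZbA x hx)
        (mem_sdiff.1 hx).2 y (hZbA y hy) (mem_sdiff.1 hy).2 hxy c1 c2))
    (fun x hx => mem_image.1 (hXb hx)) cXb (min Xb.card (Zb.card / 2)) (min_le_left _ _)
    (by have := min_le_right Xb.card (Zb.card / 2); omega)
  refine ⟨P.card, Q.card, (A \ cells P univ).card, Eb.card, Er.card, D.card, Xr.card, Xb.card, Zr.card,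
    Zb.card, min Xr.card (Zr.card / 2), min Xb.card (Zb.card / 2), by omega, by omega, cov1, cov2,
    kD, kX, kZr, kZb, by omega, by omega, ?_⟩
  rcases kLL with h | h
  · exact Or.inl ⟨⟨_, Ur, cUr, by omega⟩, ⟨_, Ub, cUb, by omega⟩⟩
  · exact Or.inr ⟨⟨_, Ub, cUb, by omega⟩, ⟨_, Ur, cUr, by omega⟩⟩

end
end

theorem num_core (n k p q a fb fr D xr xb zr zb mr mb b t : ℝ)
    (ht0 : 0 < t) (ht2 : t * t = 1 / 7)
    (hn : 0 ≤ n) (hk1 : (28 * t + 2) / 27 * n - 1 < k) (hk2 : k ≤ (28 * t + 2) / 27 * n)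
    (hp : 0 ≤ p) (hq : 0 ≤ q) (ha : 0 ≤ a) (hfb : 0 ≤ fb) (hfr : 0 ≤ fr) (hmr0 : 0 ≤ mr) (hmb0 : 0 ≤ mb)
    (hka : k = 5 * p + a) (hb : b = p + q) (h5b : 5 * b ≤ n)
    (h1 : 3 * p + fb < (1 - t) * k - 7) (h2 : 3 * p + a - 5 + fr < (1 - t) * k - 7)
    (hD : p ≤ D + fb + fr) (hX : D ≤ xr + xb + 5)
    (hzr : 2 * q ≤ zr + 2 * fb) (hzb : 2 * q ≤ zb + a + 2 * fr)
    (hmr : mr = xr ∨ zr ≤ 2 * mr + 1) (hmb : mb = xb ∨ zb ≤ 2 * mb + 1)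
    (hL : (n - 2 * b - 9 + mr < (1 - t) * n - 7 ∧ 3 * b - 4 + mb < (1 - t) * n - 7) ∨
      (n - 2 * b - 9 + mb < (1 - t) * n - 7 ∧ 3 * b - 4 + mr < (1 - t) * n - 7)) : False := by
  have ht3 : t ≤ 378 / 1000 := by nlinarith
  have ht4 : 3779 / 10000 ≤ t := by nlinarith
  have htk1 : (4 * n + 2 * (t * n)) / 27 - t ≤ t * k := by
    have := mul_le_mul_of_nonneg_left hk1.le ht0.le
    have e : t * ((28 * t + 2) / 27 * n - 1) = (28 * (t * t) * n + 2 * (t * n)) / 27 - t := by ring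
    rw [e, ht2] at this; linarith
  have htk2 : t * k ≤ (4 * n + 2 * (t * n)) / 27 := by
    have := mul_le_mul_of_nonneg_left hk2 ht0.le
    have e : t * ((28 * t + 2) / 27 * n) = (28 * (t * t) * n + 2 * (t * n)) / 27 := by ring
    rw [e, ht2] at this; linarith
  have htn1 : 3779 / 10000 * n ≤ t * n := mul_le_mul_of_nonneg_right ht4 hn
  have htn2 : t * n ≤ 378 / 1000 * n := mul_le_mul_of_nonneg_right ht3 hn
  have hk1' : (28 * (t * n) + 2 * n) / 27 - 1 < k := by linarith
  have hk2' : k ≤ (28 * (t * n) + 2 * n) / 27 := by linarith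
  have e1 : (1 - t) * k = k - t * k := by ring
  have e2 : (1 - t) * n = n - t * n := by ring
  rw [e1] at h1 h2
  rw [e2] at hL
  generalize t * n = tn at *
  generalize t * k = tk at *
  clear e1 e2 hk1 hk2 ht2
  rcases hmr with hmr | hmr <;> rcases hmb with hmb | hmb <;> rcases hL with ⟨hL1, hL2⟩ | ⟨hL1, hL2⟩
  · linarith
  · linarith
  · linarith
  · linarith
  · linarith
  · linarith
  · linarith
  · linarith

/-- With `δ = (4√7+2)/27` and `γ = 1 - 1/√7`: for every 2-edge-coloring of `K_n` (on the
vertex set `{1, …, n}`, here realized as `Fin n`, vertex `v` standing for the number `v+1`)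
there is `k ∈ {⌊δn⌋, n}` and a monochromatic family of disjoint triangles having at least
`γk - 7` vertices among `{1, …, k}`. -/
theorem stmt_5 (n : ℕ) (c : Fin n → Fin n → Bool) (hsym : ∀ x y, c x y = c y x) :
    ∃ (k : ℕ) (col : Bool) (F : Finset (Finset (Fin n))),
      (k = ⌊((4 * Real.sqrt 7 + 2) / 27) * n⌋₊ ∨ k = n) ∧
      (∀ T ∈ F, IsTri c col T) ∧ (F : Set (Finset (Fin n))).Pairwise Disjoint ∧
      (1 - 1 / Real.sqrt 7) * k - 7 ≤
        (((F.biUnion id).filter (fun v : Fin n => (v : ℕ) < k)).card : ℝ) := by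
  have hs0 : (0:ℝ) < Real.sqrt 7 := Real.sqrt_pos.2 (by norm_num)
  have hs2 : Real.sqrt 7 * Real.sqrt 7 = 7 := Real.mul_self_sqrt (by norm_num)
  set t : ℝ := 1 / Real.sqrt 7 with ht
  have hst : Real.sqrt 7 = 7 * t := by
    rw [ht]; field_simp; linarith
  have ht0 : 0 < t := by positivity
  have ht2 : t * t = 1 / 7 := by rw [hst] at hs2; linarith
  have hδ : (4 * Real.sqrt 7 + 2) / 27 = (28 * t + 2) / 27 := by rw [hst]; ring
  rw [hδ]
  set k : ℕ := ⌊((28 * t + 2) / 27) * (n : ℝ)⌋₊ with hk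
  have hn0 : (0:ℝ) ≤ n := Nat.cast_nonneg n
  have hk2 : (k : ℝ) ≤ (28 * t + 2) / 27 * n := Nat.floor_le (by positivity)
  have hk1 : (28 * t + 2) / 27 * (n : ℝ) - 1 < k := by
    have := Nat.lt_floor_add_one ((28 * t + 2) / 27 * (n : ℝ))
    linarith
  have hkn : k ≤ n := by
    have ht3 : t ≤ 378 / 1000 := by nlinarith
    have : (28 * t + 2) / 27 * (n : ℝ) ≤ 1 * n := mul_le_mul_of_nonneg_right (by linarith) hn0
    exact_mod_cast (show (k : ℝ) ≤ n by linarith)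
  by_contra hcon
  have fail : ∀ (k' : ℕ), (k' = k ∨ k' = n) → ∀ col U, Cov c col U →
      ((U.filter (fun v : Fin n => (v : ℕ) < k')).card : ℝ) < (1 - t) * k' - 7 := by
    intro k' hk' col U ⟨F, h1, h2, h3⟩
    by_contra hlt
    exact hcon ⟨k', col, F, hk', h1, h2, by rw [h3]; exact not_lt.1 hlt⟩
  have failA : ∀ col U, Cov c col U →
      ((U ∩ Finset.univ.filter (fun v : Fin n => (v : ℕ) < k)).card : ℝ) < (1 - t) * k - 7 := by
    intro col U hU
    have := fail k (Or.inl rfl) col U hU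
    rwa [Finset.inter_filter, Finset.inter_univ]
  have failV : ∀ col U, Cov c col U → (U.card : ℝ) < (1 - t) * n - 7 := by
    intro col U hU
    have := fail n (Or.inr rfl) col U hU
    rwa [Finset.filter_true_of_mem (fun v _ => v.2)] at this
  have hAk : (Finset.univ.filter (fun v : Fin n => (v : ℕ) < k)).card = k := by
    rw [Fin.card_filter_val_lt, min_eq_right hkn]
  obtain ⟨p, q, a, fb, fr, D, xr, xb, zr, zb, mr, mb, e1, e2, ⟨_, U1, c1, l1⟩, ⟨_, U2, c2, l2⟩,
    e3, e4, e5, e6, e7, e8, hL⟩ := comb hsym (Finset.univ.filter (fun v : Fin n => (v : ℕ) < k))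
  rw [hAk] at e1
  rw [Fintype.card_fin] at e2 hL
  have f1 := failA _ _ c1
  have f2 := failA _ _ c2
  have l1' : (3 * p + fb : ℝ) ≤ ((U1 ∩ Finset.univ.filter (fun v : Fin n => (v : ℕ) < k)).card : ℝ) := by exact_mod_cast l1
  have l2' : (3 * p + a + fr : ℝ) ≤ ((U2 ∩ Finset.univ.filter (fun v : Fin n => (v : ℕ) < k)).card : ℝ) + 5 := by exact_mod_cast l2
  refine num_core n k p q a fb fr D xr xb zr zb mr mb (p + q) t ht0 ht2 hn0 hk1 hk2
    (by positivity) (by positivity) (by positivity) (by positivity) (by positivity) (by positivity)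
    (by positivity) (by exact_mod_cast e1) rfl (by exact_mod_cast e2) (by linarith) (by linarith)
    (by exact_mod_cast e3) (by exact_mod_cast e4) (by exact_mod_cast e5) (by exact_mod_cast e6)
    (by exact_mod_cast e7) (by exact_mod_cast e8) ?_
  rcases hL with ⟨⟨_, U3, c3, l3⟩, ⟨_, U4, c4, l4⟩⟩ | ⟨⟨_, U3, c3, l3⟩, ⟨_, U4, c4, l4⟩⟩
  · left
    have f3 := failV _ _ c3
    have f4 := failV _ _ c4
    have l3' : (n + mr : ℝ) ≤ U3.card + 2 * (p + q) + 9 := by exact_mod_cast l3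
    have l4' : (3 * (p + q) + mb : ℝ) ≤ U4.card + 4 := by exact_mod_cast l4
    exact ⟨by linarith, by linarith⟩
  · right
    have f3 := failV _ _ c3
    have f4 := failV _ _ c4
    have l3' : (n + mb : ℝ) ≤ U3.card + 2 * (p + q) + 9 := by exact_mod_cast l3
    have l4' : (3 * (p + q) + mr : ℝ) ≤ U4.card + 4 := by exact_mod_cast l4
    exact ⟨by linarith, by linarith⟩
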